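/- Let K ∈ ℝ, N ∈ [1,∞), D ∈ (0,∞), and define the synthetic comparison isoperimetric profile I^s_{K,N,D}(v) := inf{ ν⁺(A) : A ⊆ [0,D] Borel, ν(A) = v, ν ∈ F^s_{K,N,D} }, where ν⁺ is the outer Minkowski content computed in ([0,D], Euclidean distance, ν). Then for every μ ∈ F^s_{K,N,D}, every v ∈ [0,1] and every Borel set E ⊆ [0,D] with μ(E) = v, one has P_{([0,D],|·|,μ)}(E) ≥ I^s_{K,N,D}(v). -/

import Mathlib

open Filter MeasureTheory Set Metric Topology ENNReal

/-- The slope (local Lipschitz constant) of `u` at `x`: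
`|∇u|(x) = limsup_{y→x} |u(x)-u(y)|/d(x,y)`, interpreted as `0` when `x` is isolated. -/
noncomputable def slopeAt {X : Type*} [MetricSpace X] (u : X → ℝ) (x : X) : ℝ :=
  Filter.limsup (fun y => |u x - u y| / dist x y) (𝓝[≠] x)

/-- The perimeter of a set `E` in a metric measure space: the infimum of
`liminf_n ∫ |∇u_n| dμ` over sequences of Lipschitz functions converging to `χ_E` in `L¹(μ)`. -/
noncomputable def perimeter {X : Type*} [MetricSpace X] [MeasurableSpace X]
    (μ : Measure X) (E : Set X) : ℝ≥0∞ :=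
  sInf { p : ℝ≥0∞ | ∃ u : ℕ → X → ℝ,
    (∀ n, ∃ K : NNReal, LipschitzWith K (u n)) ∧
    Filter.Tendsto
      (fun n => ∫⁻ x, ENNReal.ofReal |u n x - E.indicator (fun _ => (1:ℝ)) x| ∂μ)
      atTop (𝓝 0) ∧
    p = Filter.liminf (fun n => ∫⁻ x, ENNReal.ofReal (slopeAt (u n) x) ∂μ) atTop }

/-- The outer Minkowski content of `E`:
`μ⁺(E) = liminf_{ε↓0} (μ(E^ε) - μ(E))/ε`, where `E^ε = {x : d(x,E) ≤ ε}`. -/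
noncomputable def minkContent {X : Type*} [MetricSpace X] [MeasurableSpace X]
    (μ : Measure X) (E : Set X) : ℝ≥0∞ :=
  Filter.liminf (fun ε : ℝ => (μ (Metric.cthickening ε E) - μ E) / ENNReal.ofReal ε) (𝓝[>] 0)

/-- Perimeter computed in a metric measure subspace `(S, Euclidean distance, μ)` of `ℝ`. -/
noncomputable def perimeterOn (S : Set ℝ) (μ : Measure ℝ) (E : Set ℝ) : ℝ≥0∞ :=
  perimeter (Measure.comap (Subtype.val : S → ℝ) μ) ((Subtype.val : S → ℝ) ⁻¹' E)

/-- Outer Minkowski content computed in a metric measure subspace `(S, Euclidean distance, μ)`. -/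
noncomputable def minkOn (S : Set ℝ) (μ : Measure ℝ) (E : Set ℝ) : ℝ≥0∞ :=
  minkContent (Measure.comap (Subtype.val : S → ℝ) μ) ((Subtype.val : S → ℝ) ⁻¹' E)

/-- The measure `h · L¹` on `ℝ`. -/
noncomputable def densMeasure (h : ℝ → ℝ) : Measure ℝ :=
  (volume : Measure ℝ).withDensity (fun t => ENNReal.ofReal (h t))

/-- The distortion coefficients `σ^{(t)}_{K,N'}(θ)`. -/
noncomputable def sigmaCoef (K N' : ℝ) (t θ : ℝ) : ℝ≥0∞ :=
  if N' * Real.pi ^ 2 ≤ K * θ ^ 2 then ∞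
  else if 0 < K * θ ^ 2 then
    ENNReal.ofReal (Real.sin (t * θ * Real.sqrt (K / N')) / Real.sin (θ * Real.sqrt (K / N')))
  else if K * θ ^ 2 = 0 ∨ N' = 0 then ENNReal.ofReal t
  else
    ENNReal.ofReal (Real.sinh (t * θ * Real.sqrt (-K / N')) / Real.sinh (θ * Real.sqrt (-K / N')))

/-- The `CD(K,N)` concavity-type condition for a one-dimensional density `h` on a set `S`:
`h((1-s)t₀+st₁)^{1/(N-1)} ≥ σ^{(1-s)}_{K,N-1}(t₁-t₀) h(t₀)^{1/(N-1)} + σ^{(s)}_{K,N-1}(t₁-t₀) h(t₁)^{1/(N-1)}`. -/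
def CDDensity (K N : ℝ) (S : Set ℝ) (h : ℝ → ℝ) : Prop :=
  ∀ s ∈ Set.Icc (0:ℝ) 1, ∀ t₀ ∈ S, ∀ t₁ ∈ S, t₀ < t₁ →
    sigmaCoef K (N - 1) (1 - s) (t₁ - t₀) * ENNReal.ofReal (h t₀ ^ (1 / (N - 1))) +
        sigmaCoef K (N - 1) s (t₁ - t₀) * ENNReal.ofReal (h t₁ ^ (1 / (N - 1)))
      ≤ ENNReal.ofReal (h ((1 - s) * t₀ + s * t₁) ^ (1 / (N - 1)))

/-- Membership in the family `F^s_{K,N,D}` of synthetic `CD(K,N)` probability densities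
supported in `[0,D]`. -/
def memSynthF (K N D : ℝ) (h : ℝ → ℝ) : Prop :=
  (∀ t, 0 ≤ h t) ∧
  Function.support h ⊆ Set.Icc 0 D ∧
  IsProbabilityMeasure (densMeasure h) ∧
  (1 < N → Continuous h ∧ CDDensity K N (closure (Function.support h)) h) ∧
  (N = 1 → ∀ t₀ ∈ closure (Function.support h), ∀ t₁ ∈ closure (Function.support h),
     h t₀ = h t₁)

/-- The synthetic comparison isoperimetric profile
`I^s_{K,N,D}(v) = inf { ν⁺(A) : A ⊆ [0,D] Borel, ν(A) = v, ν ∈ F^s_{K,N,D} }`,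
where `ν⁺` is the outer Minkowski content in `([0,D], |·|, ν)`. -/
noncomputable def synthProfile (K N D : ℝ) (v : ℝ) : ℝ≥0∞ :=
  sInf { m : ℝ≥0∞ | ∃ g : ℝ → ℝ, memSynthF K N D g ∧ ∃ A : Set ℝ, MeasurableSet A ∧
    A ⊆ Set.Icc 0 D ∧ densMeasure g A = ENNReal.ofReal v ∧
    m = minkOn (Set.Icc 0 D) (densMeasure g) A }

lemma aux_cth_sub (S : Set ℝ) (A : Set ℝ) (ε : ℝ) :
    (Subtype.val : S → ℝ) '' (Metric.cthickening ε ((Subtype.val : S → ℝ) ⁻¹' A)) ⊆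
      Metric.cthickening ε A := by
  rintro _ ⟨x, hx, rfl⟩
  rw [Metric.mem_cthickening_iff] at hx ⊢
  rw [← Metric.infEDist_image (isometry_subtype_coe (s := S))] at hx
  exact (Metric.infEDist_anti (Set.image_preimage_subset _ _)).trans hx

lemma aux_mink_le (D : ℝ) (μ : Measure ℝ) (A : Set ℝ)
    (C : ℝ≥0∞)
    (h : ∀ᶠ ε in 𝓝[>] (0:ℝ), μ (Metric.cthickening ε A \ A) ≤ ENNReal.ofReal ε * C) :
    minkOn (Set.Icc 0 D) μ (A ∩ Set.Icc 0 D) ≤ C := by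
  unfold minkOn minkContent
  apply Filter.liminf_le_of_frequently_le'
  apply Filter.Eventually.frequently
  filter_upwards [h, self_mem_nhdsWithin] with ε hε hpos
  have hpos : 0 < ε := hpos
  rw [ENNReal.div_le_iff (by simpa using hpos) ENNReal.ofReal_ne_top]
  refine le_measure_sdiff.trans ?_
  rw [comap_subtype_coe_apply measurableSet_Icc, mul_comm]
  refine le_trans (measure_mono ?_) hε
  rintro _ ⟨x, ⟨hx1, hx2⟩, rfl⟩
  refine ⟨aux_cth_sub _ _ _ ⟨x, ?_, rfl⟩, fun h => hx2 ⟨h, x.2⟩⟩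
  exact Metric.cthickening_subset_of_subset _ (Set.preimage_mono Set.inter_subset_left) hx1

lemma aux_cth_Iic (c ε : ℝ) (hε : 0 < ε) :
    Metric.cthickening ε (Set.Iic c) ⊆ Set.Iic (c + ε) := by
  intro x hx
  rw [Metric.cthickening_eq_iInter_thickening hε.le] at hx
  simp only [Set.mem_iInter] at hx
  rw [Set.mem_Iic]
  refine _root_.le_of_forall_pos_le_add fun δ hδ => ?_
  obtain ⟨z, hz, hd⟩ := Metric.mem_thickening_iff.1 (hx (ε + δ) (by linarith))
  rw [Real.dist_eq] at hd
  have := (abs_lt.1 hd).2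
  have : z ≤ c := hz
  linarith

lemma aux_cth_Ioi (c ε : ℝ) (hε : 0 < ε) :
    Metric.cthickening ε (Set.Ioi c) ⊆ Set.Ici (c - ε) := by
  intro x hx
  rw [Metric.cthickening_eq_iInter_thickening hε.le] at hx
  simp only [Set.mem_iInter] at hx
  rw [Set.mem_Ici]
  refine _root_.le_of_forall_pos_le_add fun δ hδ => ?_
  obtain ⟨z, hz, hd⟩ := Metric.mem_thickening_iff.1 (hx (ε + δ) (by linarith))
  rw [Real.dist_eq] at hd
  have := (abs_lt.1 hd).1
  have : c < z := hz
  linarith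

lemma aux_cost_inter (A : Set ℝ) (c ε : ℝ) (hε : 0 < ε) :
    Metric.cthickening ε (A ∩ Set.Iic c) \ (A ∩ Set.Iic c) ⊆
      (Metric.cthickening ε A \ A) ∪ Set.Icc c (c + ε) := by
  rintro x ⟨hx, hn⟩
  have h1 := Metric.cthickening_subset_of_subset ε (Set.inter_subset_left) hx
  have h2 : x ≤ c + ε :=
    aux_cth_Iic c ε hε (Metric.cthickening_subset_of_subset ε (Set.inter_subset_right) hx)
  by_cases hxc : x ≤ c
  · exact Or.inl ⟨h1, fun h => hn ⟨h, hxc⟩⟩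
  · exact Or.inr ⟨(not_le.1 hxc).le, h2⟩

lemma aux_cost_union (A : Set ℝ) (c ε : ℝ) (hε : 0 < ε) :
    Metric.cthickening ε (A ∪ Set.Ioi c) \ (A ∪ Set.Ioi c) ⊆
      (Metric.cthickening ε A \ A) ∪ Set.Icc (c - ε) c := by
  rintro x ⟨hx, hn⟩
  rw [Metric.cthickening_union] at hx
  rcases hx with hx | hx
  · exact Or.inl ⟨hx, fun h => hn (Or.inl h)⟩
  · exact Or.inr ⟨aux_cth_Ioi c ε hε hx, not_lt.1 fun h => hn (Or.inr h)⟩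

/-- measure of an interval under a density bounded by `M`. -/
lemma aux_dens_Icc (h : ℝ → ℝ) (a b M : ℝ) (hM : ∀ t ∈ Set.Icc a b, h t ≤ M) :
    densMeasure h (Set.Icc a b) ≤ ENNReal.ofReal (b - a) * ENNReal.ofReal M := by
  unfold densMeasure
  rw [withDensity_apply _ measurableSet_Icc]
  calc _ ≤ ∫⁻ t in Set.Icc a b, ENNReal.ofReal M := by
        apply setLIntegral_mono measurable_const
        intro t ht
        exact ENNReal.ofReal_le_ofReal (hM t ht)
    _ = _ := by rw [setLIntegral_const, Real.volume_Icc, mul_comm]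

lemma aux_liminf_add (f g : ℕ → ℝ≥0∞) :
    liminf f atTop + liminf g atTop ≤ liminf (fun n => f n + g n) atTop := by
  rw [liminf_eq_iSup_iInf_of_nat, liminf_eq_iSup_iInf_of_nat, liminf_eq_iSup_iInf_of_nat]
  refine ENNReal.iSup_add_iSup_le fun i j => ?_
  refine le_iSup_of_le (max i j) ?_
  refine le_iInf₂ fun n hn => ?_
  exact add_le_add (iInf₂_le n (le_trans (le_max_left _ _) hn))
    (iInf₂_le n (le_trans (le_max_right _ _) hn))

/-- lower bound of the weighted total variation between two points -/
lemma aux_ftc (h : ℝ → ℝ) (f : ℝ → ℝ) (hf : ∃ K : NNReal, LipschitzWith K f)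
    (p q κ : ℝ) (hpq : p ≤ q) (hκ : ∀ t ∈ Set.Icc p q, κ ≤ h t)  (hm : Measurable h) :
    ENNReal.ofReal κ * ENNReal.ofReal |f q - f p| ≤
      ∫⁻ t in Set.Ioc p q, ENNReal.ofReal |deriv f t| ∂(densMeasure h) := by
  obtain ⟨K, hK⟩ := hf
  have hac : AbsolutelyContinuousOnInterval f p q :=
    (hK.lipschitzOnWith (s := Set.uIcc p q)).absolutelyContinuousOnInterval
  have e1 := hac.integral_deriv_eq_sub
  rw [← e1, intervalIntegral.integral_of_le hpq]
  have e2 : ENNReal.ofReal |∫ x in Set.Ioc p q, deriv f x| ≤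
      ∫⁻ x in Set.Ioc p q, ENNReal.ofReal |deriv f x| := by
    have := enorm_integral_le_lintegral_enorm (μ := volume.restrict (Set.Ioc p q)) (deriv f)
    simpa [Real.enorm_eq_ofReal_abs] using this
  unfold densMeasure
  rw [restrict_withDensity measurableSet_Ioc,
    lintegral_withDensity_eq_lintegral_mul _ (by fun_prop)
      ((measurable_deriv f).abs.ennreal_ofReal)]
  calc _ ≤ ENNReal.ofReal κ * ∫⁻ x in Set.Ioc p q, ENNReal.ofReal |deriv f x| := by gcongr
    _ = ∫⁻ x in Set.Ioc p q, ENNReal.ofReal κ * ENNReal.ofReal |deriv f x| := by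
        rw [lintegral_const_mul _ ((measurable_deriv f).abs.ennreal_ofReal)]
    _ ≤ _ := by
        apply setLIntegral_mono_ae'  measurableSet_Ioc
        refine Filter.Eventually.of_forall fun t ht => ?_
        simp only [Pi.mul_apply]
        gcongr
        exact hκ t ⟨ht.1.le, ht.2⟩

lemma aux_slope (D : ℝ) (hD : 0 ≤ D) (u : Set.Icc (0:ℝ) D → ℝ) (x : Set.Icc (0:ℝ) D)
    (hx : (x:ℝ) ∈ Set.Ioo 0 D)
    (hd : DifferentiableAt ℝ (Set.IccExtend hD u) x) :
    slopeAt u x = |deriv (Set.IccExtend hD u) x| := by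
  have h1 := hd.hasDerivAt.tendsto_slope
  have hval : Tendsto (Subtype.val : Set.Icc (0:ℝ) D → ℝ) (𝓝[≠] x) (𝓝[≠] (x:ℝ)) := by
    refine tendsto_nhdsWithin_of_tendsto_nhds_of_eventually_within _
      (continuous_subtype_val.continuousAt.mono_left nhdsWithin_le_nhds) ?_
    filter_upwards [self_mem_nhdsWithin] with y hy h
    exact hy (Subtype.ext h)
  have h2 := (h1.comp hval).abs
  have hnb : (𝓝[≠] x).NeBot := by
    have hb : (𝓝[≠] (x:ℝ)).NeBot := inferInstance
    have hc : (Filter.comap (Subtype.val : Set.Icc (0:ℝ) D → ℝ) (𝓝[≠] (x:ℝ))).NeBot := by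
      refine Filter.NeBot.comap_of_range_mem hb ?_
      rw [Subtype.range_coe]
      exact mem_nhdsWithin_of_mem_nhds (Icc_mem_nhds hx.1 hx.2)
    refine hc.mono ?_
    rw [nhdsWithin, nhdsWithin, Filter.comap_inf, Filter.comap_principal, nhds_subtype_eq_comap]
    refine inf_le_inf le_rfl ?_
    rw [Filter.principal_mono]
    intro y hy h
    exact hy (congrArg Subtype.val h)
  unfold slopeAt
  apply Filter.Tendsto.limsup_eq
  refine h2.congr fun y => ?_
  simp only [Function.comp, slope_def_field, abs_div, Set.IccExtend_val, Subtype.dist_eq,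
    Real.dist_eq]
  rw [abs_sub_comm (u y), abs_sub_comm (y:ℝ)]

lemma aux_slope_int (D : ℝ) (hD : 0 ≤ D) (u : Set.Icc (0:ℝ) D → ℝ)
    (hu : ∃ K : NNReal, LipschitzWith K u) (h : ℝ → ℝ) 
    (hs : ∀ t, t ∉ Set.Ioo 0 D → h t = 0) (hm : Measurable h) :
    ∫⁻ t, ENNReal.ofReal |deriv (Set.IccExtend hD u) t| ∂(densMeasure h) ≤
    ∫⁻ x, ENNReal.ofReal (slopeAt u x) ∂(Measure.comap (Subtype.val : Set.Icc 0 D → ℝ) (densMeasure h)) := by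
  have hae : ∀ᵐ t ∂(densMeasure h), t ∈ Set.Ioo 0 D := by
    unfold densMeasure
    rw [ae_withDensity_iff (by fun_prop)]
    refine Filter.Eventually.of_forall fun t ht => ?_
    by_contra hc
    simp [hs t hc] at ht
  obtain ⟨K, hK⟩ := hu
  have hL : LipschitzWith K (Set.IccExtend hD u) := by
    have := hK.comp (LipschitzWith.projIcc hD)
    simpa [Set.IccExtend] using this
  have hdiff : ∀ᵐ t ∂(densMeasure h), DifferentiableAt ℝ (Set.IccExtend hD u) t :=
    (withDensity_absolutelyContinuous _ _).ae_le hL.ae_differentiableAt_real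
  have h1 : densMeasure h = (densMeasure h).restrict (Set.Icc 0 D) := by
    rw [Measure.restrict_eq_self_of_ae_mem]
    filter_upwards [hae] with t ht using Set.Ioo_subset_Icc_self ht
  have h2 : ∫⁻ t, ENNReal.ofReal |deriv (Set.IccExtend hD u) t| ∂(densMeasure h) =
      ∫⁻ x : Set.Icc (0:ℝ) D, ENNReal.ofReal |deriv (Set.IccExtend hD u) x| ∂(Measure.comap (Subtype.val : Set.Icc 0 D → ℝ) (densMeasure h)) := by
    rw [lintegral_subtype_comap measurableSet_Icc 
      (fun t => ENNReal.ofReal |deriv (Set.IccExtend hD u) t|), ← h1]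
  rw [h2]
  apply lintegral_mono_ae
  have hae2 := hae.and hdiff
  rw [ae_iff] at hae2 ⊢
  rw [comap_subtype_coe_apply measurableSet_Icc]
  refine measure_mono_null ?_ hae2
  rintro _ ⟨x, hx, rfl⟩ ⟨h3, h4⟩
  exact hx (by rw [aux_slope D hD u x h3 h4])

lemma aux_ivt (h : ℝ → ℝ) (hc : Continuous h) (h0 : ∀ t, 0 ≤ h t) (p q : ℝ) (hpq : p ≤ q)
    (m : ℝ≥0∞) (hm : m ≤ densMeasure h (Set.Ioc p q)) :
    ∃ c ∈ Set.Icc p q, densMeasure h (Set.Ioc p c) = m := by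
  have key : ∀ c, p ≤ c → densMeasure h (Set.Ioc p c) = ENNReal.ofReal (∫ t in p..c, h t) := by
    intro c hpc
    unfold densMeasure
    rw [withDensity_apply _ measurableSet_Ioc, intervalIntegral.integral_of_le hpc,
      ofReal_integral_eq_lintegral_ofReal]
    · exact (hc.integrableOn_Icc (a := p) (b := c)).mono_set Set.Ioc_subset_Icc_self
    · exact Filter.Eventually.of_forall h0
  have hcont : Continuous fun c => ∫ t in p..c, h t :=
    intervalIntegral.continuous_primitive (fun a b => hc.intervalIntegrable a b) p
  have hmt : m ≠ ∞ := by
    rw [key q hpq] at hm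
    exact ne_top_of_le_ne_top ENNReal.ofReal_ne_top hm
  have h1 := intermediate_value_Icc hpq hcont.continuousOn
  have h2 : m.toReal ∈ Set.Icc (∫ t in p..p, h t) (∫ t in p..q, h t) := by
    constructor
    · simp
    · rw [key q hpq] at hm
      exact ENNReal.toReal_le_of_le_ofReal
        (intervalIntegral.integral_nonneg hpq fun t _ => h0 t) hm
  obtain ⟨c, hc1, hc2⟩ := h1 h2
  refine ⟨c, hc1, ?_⟩
  simp only at hc2
  rw [key c hc1.1, hc2, ENNReal.ofReal_toReal hmt]

/-- The inductive construction: `A` is a replacement for `E` up to the point `q`. -/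
def InvC (h : ℝ → ℝ) (E : Set ℝ) (q : ℝ) (b : Prop) (C : ℝ≥0∞) (A : Set ℝ) : Prop :=
  MeasurableSet A ∧ (b → Set.Ioi q ⊆ A) ∧ (¬ b → A ⊆ Set.Iic q) ∧
  densMeasure h (A ∩ Set.Iic q) = densMeasure h (E ∩ Set.Iic q) ∧
  ∀ᶠ ε in 𝓝[>] (0:ℝ), densMeasure h (Metric.cthickening ε A \ A) ≤ ENNReal.ofReal ε * C

lemma aux_split (h : ℝ → ℝ) (E : Set ℝ) (q q' : ℝ) (hq : q ≤ q') :
    densMeasure h (E ∩ Set.Iic q') =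
      densMeasure h (E ∩ Set.Iic q) + densMeasure h (E ∩ Set.Ioc q q') := by
  rw [← measure_inter_add_sdiff (E ∩ Set.Iic q') (measurableSet_Iic (a := q))]
  congr 2
  · rw [Set.inter_assoc, Set.Iic_inter_Iic, min_eq_right hq]
  · ext t; simp only [Set.mem_sdiff, Set.mem_inter_iff, Set.mem_Iic, Set.mem_Ioc, not_le]; tauto

lemma InvC.triv {h : ℝ → ℝ} {E : Set ℝ} {q q' : ℝ} (hq : q ≤ q') {b : Prop} {C : ℝ≥0∞}
    {A : Set ℝ} (hA : InvC h E q b C A)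
    (h1 : b → densMeasure h (E ∩ Set.Ioc q q') = densMeasure h (Set.Ioc q q'))
    (h2 : ¬ b → densMeasure h (E ∩ Set.Ioc q q') = 0) : InvC h E q' b C A := by
  obtain ⟨a1, a2, a3, a4, a5⟩ := hA
  refine ⟨a1, fun hb => (Set.Ioi_subset_Ioi hq).trans (a2 hb),
    fun hb => (a3 hb).trans (Set.Iic_subset_Iic.2 hq), ?_, a5⟩
  rw [aux_split h E q q' hq, aux_split h A q q' hq, a4]
  congr 1
  by_cases hb : b
  · rw [h1 hb]
    congr 1
    exact Set.inter_eq_right.2 fun t ht => a2 hb ht.1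
  · rw [h2 hb]
    have : A ∩ Set.Ioc q q' = ∅ := by
      ext t
      simp only [Set.mem_inter_iff, Set.mem_empty_iff_false, iff_false]
      rintro ⟨h3, h4⟩
      exact absurd (a3 hb h3) (not_le.2 h4.1)
    rw [this, measure_empty]

lemma InvC.mono {h : ℝ → ℝ} {E : Set ℝ} {q : ℝ} {b : Prop} {C C' : ℝ≥0∞}
    {A : Set ℝ} (hA : InvC h E q b C A) (hC : C ≤ C') : InvC h E q b C' A := by
  obtain ⟨a1, a2, a3, a4, a5⟩ := hA
  refine ⟨a1, a2, a3, a4, ?_⟩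
  filter_upwards [a5] with ε hε
  exact hε.trans (by gcongr)

lemma InvC.step {h : ℝ → ℝ} (hc : Continuous h) (h0 : ∀ t, 0 ≤ h t)
    [IsProbabilityMeasure (densMeasure h)] {E : Set ℝ} 
    {q q' : ℝ} (hq : q ≤ q') {b : Prop} {C : ℝ≥0∞}
    {A : Set ℝ} (hA : InvC h E q b C A) (M ρ : ℝ) (hρ : 0 < ρ)
    (hM : ∀ t ∈ Set.Icc (q - ρ) (q' + ρ), h t ≤ M) :
    ∃ A', InvC h E q' (¬ b) (C + ENNReal.ofReal M) A' := by
  obtain ⟨a1, a2, a3, a4, a5⟩ := hA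
  have hρ' : ∀ᶠ ε in 𝓝[>] (0:ℝ), ε < ρ := nhdsWithin_le_nhds (Iio_mem_nhds hρ)
  have hle : densMeasure h (E ∩ Set.Ioc q q') ≤ densMeasure h (Set.Ioc q q') :=
    measure_mono Set.inter_subset_right
  by_cases hb : b
  · obtain ⟨c, hc1, hc2⟩ := aux_ivt h hc h0 q q' hq _ hle
    refine ⟨A ∩ Set.Iic c, a1.inter measurableSet_Iic, fun h => absurd hb h,
      fun _ => Set.inter_subset_right.trans (Set.Iic_subset_Iic.2 hc1.2), ?_, ?_⟩
    · rw [aux_split h E q q' hq, ← hc2, ← a4, Set.inter_assoc, Set.Iic_inter_Iic,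
        min_eq_left hc1.2, aux_split h A q c hc1.1]
      congr 2
      exact Set.inter_eq_right.2 fun t ht => a2 hb ht.1
    · filter_upwards [a5, hρ', self_mem_nhdsWithin] with ε h5 h6 h7
      refine (measure_mono (aux_cost_inter A c ε h7)).trans ?_
      refine (measure_union_le _ _).trans ?_
      rw [mul_add]
      refine add_le_add h5 ?_
      have := aux_dens_Icc h c (c + ε) M fun t ht => hM t ⟨by linarith [ht.1, hc1.1], by
        linarith [ht.2, hc1.2]⟩
      simpa using this
  · obtain ⟨c, hc1, hc2⟩ := aux_ivt h hc h0 q q' hq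
      (densMeasure h (Set.Ioc q q') - densMeasure h (E ∩ Set.Ioc q q')) tsub_le_self
    have hc3 : densMeasure h (Set.Ioc c q') = densMeasure h (E ∩ Set.Ioc q q') := by
      have e1 : densMeasure h (Set.Ioc q c) + densMeasure h (Set.Ioc c q') =
          densMeasure h (Set.Ioc q q') := by
        rw [← Set.Ioc_union_Ioc_eq_Ioc hc1.1 hc1.2, measure_union _ measurableSet_Ioc]
        rw [Set.disjoint_left]
        intro t ht ht'
        exact absurd ht.2 (not_le.2 ht'.1)
      rw [← tsub_add_cancel_of_le hle, hc2] at e1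
      exact (ENNReal.add_right_inj (ne_top_of_le_ne_top (measure_ne_top _ _) tsub_le_self)).1 e1
    have a3' := a3 hb
    refine ⟨A ∪ Set.Ioi c, a1.union measurableSet_Ioi, fun _ => (Set.Ioi_subset_Ioi hc1.2).trans
      Set.subset_union_right, fun h => absurd hb h, ?_, ?_⟩
    · rw [aux_split h E q q' hq, ← hc3, ← a4]
      rw [← measure_union _ measurableSet_Ioc]
      · congr 1
        ext t
        simp only [Set.mem_inter_iff, Set.mem_union, Set.mem_Ioi, Set.mem_Iic, Set.mem_Ioc]
        constructor
        · rintro ⟨h1 | h1, h2⟩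
          · exact Or.inl ⟨h1, a3' h1⟩
          · exact Or.inr ⟨h1, h2⟩
        · rintro (h1 | h1)
          · exact ⟨Or.inl h1.1, h1.2.trans hq⟩
          · exact ⟨Or.inr h1.1, h1.2⟩
      · rw [Set.disjoint_left]
        intro t ht ht'
        have h1 : t ≤ q := ht.2
        linarith [ht'.1, hc1.1]
    · filter_upwards [a5, hρ', self_mem_nhdsWithin] with ε h5 h6 h7
      refine (measure_mono (aux_cost_union A c ε h7)).trans ?_
      refine (measure_union_le _ _).trans ?_
      rw [mul_add]
      refine add_le_add h5 ?_
      have := aux_dens_Icc h (c - ε) c M fun t ht => hM t ⟨by linarith [ht.1, hc1.1], by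
        linarith [ht.2, hc1.2]⟩
      simpa using this

/-- one step between nearby points of `G` -/
lemma aux_step_G {h : ℝ → ℝ} (hc : Continuous h) (h0 : ∀ t, 0 ≤ h t)
    [IsProbabilityMeasure (densMeasure h)] {E : Set ℝ} 
    (G : Set ℝ) (W : ℝ → ℝ≥0∞) (x y δ ρ : ℝ) (hδ : 0 < δ) (hρ : 0 < ρ)
    (hG : ∀ᵐ t ∂volume, t ∈ Set.Icc x y → t ∈ G)
    (hWm : Monotone W)
    (hW : ∀ p ∈ G, ∀ q ∈ G, x ≤ p → q ≤ y → p < q → ¬ (p ∈ E ↔ q ∈ E) → ∀ κ, 0 ≤ κ →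
      (∀ t ∈ Set.Icc p q, κ ≤ h t) → W p + ENNReal.ofReal κ ≤ W q)
    (hosc : ∀ s, ∀ t ∈ Set.Icc x y, |s - t| ≤ 2 * ρ → h s ≤ (1 + δ) * h t)
    (p q : ℝ) (hp : p ∈ G) (hq : q ∈ G) (hxp : x ≤ p) (hqy : q ≤ y) (hpq : p < q)
    (hd : q - p ≤ ρ)
    (hI : ∃ A, InvC h E p (p ∈ E) (ENNReal.ofReal (1 + δ) * W p + ENNReal.ofReal δ) A) :
    ∃ A, InvC h E q (q ∈ E) (ENNReal.ofReal (1 + δ) * W q + ENNReal.ofReal δ) A := by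
  have diff : ∀ p ∈ G, ∀ q ∈ G, x ≤ p → q ≤ y → p < q → q - p ≤ ρ → ¬ (p ∈ E ↔ q ∈ E) → 
      (∃ A, InvC h E p (p ∈ E) (ENNReal.ofReal (1 + δ) * W p + ENNReal.ofReal δ) A) →
      ∃ A, InvC h E q (q ∈ E) (ENNReal.ofReal (1 + δ) * W q + ENNReal.ofReal δ) A := by
    rintro p hp q hq hxp hqy hpq hd hne ⟨A, hA⟩
    obtain ⟨τ, hτ, hmin⟩ := (isCompact_Icc (a := p) (b := q)).exists_isMinOn
      ⟨p, le_rfl, hpq.le⟩ hc.continuousOn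
    have hmin' : ∀ t ∈ Set.Icc p q, h τ ≤ h t := fun t ht => hmin ht
    obtain ⟨A', hA'⟩ := hA.step hc h0 hpq.le ((1 + δ) * h τ) ρ hρ (by
      intro t ht
      refine hosc t τ ⟨hxp.trans hτ.1, hτ.2.trans hqy⟩ ?_
      rw [abs_le]
      constructor <;> linarith [ht.1, ht.2, hτ.1, hτ.2])
    have hb : (¬ (p ∈ E)) = (q ∈ E) := by
      apply propext; tauto
    rw [hb] at hA'
    refine ⟨A', hA'.mono ?_⟩
    rw [ENNReal.ofReal_mul (by linarith), add_right_comm, ← mul_add]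
    gcongr
    exact hW p hp q hq hxp hqy hpq hne _ (h0 τ) hmin'
  by_cases hne : (p ∈ E ↔ q ∈ E)
  swap
  · exact diff p hp q hq hxp hqy hpq hd hne hI
  by_cases hex : ∃ r ∈ G, p < r ∧ r < q ∧ ¬ (p ∈ E ↔ r ∈ E)
  · obtain ⟨r, hr, hpr, hrq, hner⟩ := hex
    exact diff r hr q hq (hxp.trans hpr.le) hqy hrq (by linarith) (by tauto)
      (diff p hp r hr hxp (hrq.le.trans hqy) hpr (by linarith) hner hI)
  push Not at hex
  obtain ⟨A, hA⟩ := hI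
  have hEae : ∀ᵐ t ∂(densMeasure h), t ∈ Set.Ioc p q → (p ∈ E ↔ t ∈ E) := by
    refine (withDensity_absolutelyContinuous _ _).ae_le ?_
    filter_upwards [hG] with t ht ht'
    rcases eq_or_lt_of_le ht'.2 with h1 | h1
    · rw [h1]; exact hne
    · exact hex t (ht ⟨hxp.trans ht'.1.le, h1.le.trans hqy⟩) ht'.1 h1
  have hA2 := hA.triv hpq.le (by
    intro hb
    apply measure_congr
    filter_upwards [hEae] with t ht
    apply propext
    change (t ∈ E ∧ t ∈ Set.Ioc p q) ↔ t ∈ Set.Ioc p q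
    tauto) (by
    intro hb
    rw [← nonpos_iff_eq_zero, ← measure_empty (μ := densMeasure h)]
    apply le_of_eq
    apply measure_congr
    filter_upwards [hEae] with t ht
    apply propext
    change (t ∈ E ∧ t ∈ Set.Ioc p q) ↔ t ∈ (∅ : Set ℝ)
    simp only [Set.mem_empty_iff_false, iff_false]
    tauto)
  rw [propext hne] at hA2
  refine ⟨A, hA2.mono ?_⟩
  gcongr
  exact hWm hpq.le

lemma aux_chain {h : ℝ → ℝ} (hc : Continuous h) (h0 : ∀ t, 0 ≤ h t)
    [IsProbabilityMeasure (densMeasure h)] {E : Set ℝ} 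
    (G : Set ℝ) (W : ℝ → ℝ≥0∞) (x y δ ρ : ℝ) (hδ : 0 < δ) (hρ : 0 < ρ)
    (hG : ∀ᵐ t ∂volume, t ∈ Set.Icc x y → t ∈ G)
    (hWm : Monotone W)
    (hW : ∀ p ∈ G, ∀ q ∈ G, x ≤ p → q ≤ y → p < q → ¬ (p ∈ E ↔ q ∈ E) → ∀ κ, 0 ≤ κ →
      (∀ t ∈ Set.Icc p q, κ ≤ h t) → W p + ENNReal.ofReal κ ≤ W q)
    (hosc : ∀ s, ∀ t ∈ Set.Icc x y, |s - t| ≤ 2 * ρ → h s ≤ (1 + δ) * h t)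
    (hx : x ∈ G) (hy : y ∈ G) (hxy : x ≤ y)
    (hI : ∃ A, InvC h E x (x ∈ E) (ENNReal.ofReal (1 + δ) * W x + ENNReal.ofReal δ) A) :
    ∃ A, InvC h E y (y ∈ E) (ENNReal.ofReal (1 + δ) * W y + ENNReal.ofReal δ) A := by
  have step := aux_step_G hc h0 G W x y δ ρ hδ hρ hG hWm hW hosc
  have main : ∀ n : ℕ, ∀ q ∈ G, x ≤ q → q ≤ y → q - x ≤ n * (ρ / 2) →
      ∃ A, InvC h E q (q ∈ E) (ENNReal.ofReal (1 + δ) * W q + ENNReal.ofReal δ) A := by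
    intro n
    induction n with
    | zero =>
      intro q hq hxq hqy hle
      have : q = x := by
        simp at hle; linarith
      rw [this]; exact hI
    | succ n ih =>
      intro q hq hxq hqy hle
      push_cast at hle
      by_cases h1 : q - x ≤ ρ / 2
      · rcases eq_or_lt_of_le hxq with h2 | h2
        · rw [← h2]; exact hI
        · exact step x q hx hq le_rfl hqy h2 (by linarith) hI
      · have hlt : max x (q - ρ) < q - ρ / 2 := by
          apply max_lt <;> linarith
        have hne : ∃ p ∈ Set.Ioo (max x (q - ρ)) (q - ρ / 2), p ∈ G := by
          by_contra hcon
          push Not at hcon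
          have hz : volume (Set.Ioo (max x (q - ρ)) (q - ρ / 2)) = 0 := by
            refine measure_mono_null ?_ hG
            intro t ht ht'
            exact hcon t ht (ht' ⟨(le_max_left _ _).trans ht.1.le, by linarith [ht.2]⟩)
          rw [Real.volume_Ioo, ENNReal.ofReal_eq_zero] at hz
          linarith
        obtain ⟨p, hp, hpG⟩ := hne
        have hp1 := (le_max_left _ _).trans_lt hp.1
        have hp2 := (le_max_right _ _).trans_lt hp.1
        exact step p q hpG hq hp1.le hqy (by linarith [hp.2]) (by linarith)
          (ih p hpG hp1.le (by linarith [hp.2]) (by linarith [hp.2]))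
  obtain ⟨n, hn⟩ := exists_nat_ge ((y - x) / (ρ / 2))
  refine main n y hy hxy le_rfl ?_
  rwa [div_le_iff₀ (by positivity)] at hn

lemma aux_sigma (K N' s θ : ℝ) (hN : 0 < N') (hs : s ∈ Set.Ioo (0:ℝ) 1) (hθ : 0 < θ) :
    sigmaCoef K N' s θ ≠ 0 := by
  unfold sigmaCoef
  split_ifs with h1 h2 h3
  · simp
  · push Not at h1
    have hK : 0 < K := by
      by_contra hcon
      nlinarith [sq_nonneg θ]
    have hr : 0 < Real.sqrt (K / N') := Real.sqrt_pos.2 (by positivity)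
    have hlt : θ * Real.sqrt (K / N') < Real.pi := by
      refine lt_of_pow_lt_pow_left₀ 2 Real.pi_pos.le ?_
      rw [mul_pow, Real.sq_sqrt (by positivity), ← mul_div_assoc, div_lt_iff₀ hN]
      linarith
    have hpos : 0 < θ * Real.sqrt (K / N') := by positivity
    have e : s * θ * Real.sqrt (K / N') = s * (θ * Real.sqrt (K / N')) := by ring
    rw [e]
    have := Real.sin_pos_of_pos_of_lt_pi hpos hlt
    have := Real.sin_pos_of_pos_of_lt_pi (x := s * (θ * Real.sqrt (K / N')))
      (mul_pos hs.1 hpos) (by nlinarith [hs.2])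
    simp only [ne_eq, ENNReal.ofReal_eq_zero, not_le]
    positivity
  · simpa using hs.1
  · push Not at h2 h3
    have hK : K < 0 := by
      by_contra hcon
      have : 0 ≤ K * θ ^ 2 := mul_nonneg (not_lt.1 hcon) (sq_nonneg _)
      exact h3.1 (le_antisymm h2 this)
    have hr : 0 < Real.sqrt (-K / N') := Real.sqrt_pos.2 (div_pos (by linarith) hN)
    have hs1 := hs.1
    have h5 : 0 < Real.sinh (θ * Real.sqrt (-K / N')) := Real.sinh_pos_iff.2 (by positivity)
    have h6 : 0 < Real.sinh (s * θ * Real.sqrt (-K / N')) := Real.sinh_pos_iff.2 (by positivity)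
    simp only [ne_eq, ENNReal.ofReal_eq_zero, not_le]
    positivity

lemma aux_supp (K N D : ℝ) (hN : 1 < N) (h : ℝ → ℝ) (hF : memSynthF K N D h) :
    ∃ a b, 0 ≤ a ∧ a < b ∧ b ≤ D ∧ (∀ t ∈ Set.Ioo a b, 0 < h t) ∧
      (∀ t, t ∉ Set.Ioo a b → h t = 0) := by
  obtain ⟨h0, hsub, hprob, hcd, -⟩ := hF
  obtain ⟨hc, hcd⟩ := hcd hN
  set S := Function.support h with hS
  have hne : S.Nonempty := by
    by_contra hcon
    rw [Set.not_nonempty_iff_eq_empty, hS, Function.support_eq_empty_iff] at hcon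
    have h1 : densMeasure h Set.univ = 1 := measure_univ
    rw [hcon] at h1
    simp [densMeasure] at h1
  have hopen : IsOpen S := hc.isOpen_support
  have hbb : BddBelow S := ⟨0, fun t ht => (hsub ht).1⟩
  have hba : BddAbove S := ⟨D, fun t ht => (hsub ht).2⟩
  have hpos : ∀ t ∈ S, 0 < h t := fun t ht => lt_of_le_of_ne (h0 t) (Ne.symm ht)
  have hconv : ∀ t₀ ∈ S, ∀ t₁ ∈ S, ∀ t, t₀ < t → t < t₁ → t ∈ S := by
    intro t₀ ht₀ t₁ ht₁ t h1 h2
    have hlt : 0 < t₁ - t₀ := by linarith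
    set s := (t - t₀) / (t₁ - t₀) with hs
    have hs0 : 0 < s := div_pos (by linarith) hlt
    have hs1 : s < 1 := by rw [hs, div_lt_one hlt]; linarith
    have hcomb : (1 - s) * t₀ + s * t₁ = t := by
      have : s * (t₁ - t₀) = t - t₀ := by rw [hs]; field_simp
      linarith
    have := hcd s ⟨hs0.le, hs1.le⟩ t₀ (subset_closure ht₀) t₁ (subset_closure ht₁) (by linarith)
    rw [hcomb] at this
    have hp : 0 < sigmaCoef K (N - 1) s (t₁ - t₀) * ENNReal.ofReal (h t₁ ^ (1 / (N - 1))) := by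
      apply ENNReal.mul_pos (aux_sigma K (N-1) s _ (by linarith) ⟨hs0, hs1⟩ hlt)
      simp only [ne_eq, ENNReal.ofReal_eq_zero, not_le]
      exact Real.rpow_pos_of_pos (hpos _ ht₁) _
    have hp2 := hp.trans_le (le_add_self.trans this)
    intro hz
    rw [hz, Real.zero_rpow (by have : N - 1 ≠ 0 := by linarith
                               positivity)] at hp2
    simp at hp2
  have hA : ∀ t ∈ S, sInf S < t := by
    intro t ht
    refine lt_of_le_of_ne (csInf_le hbb ht) ?_
    intro he
    obtain ⟨l, hl, hl2⟩ := exists_Ioc_subset_of_mem_nhds (hopen.mem_nhds ht) ⟨t - 1, by simp⟩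
    have : (l + t) / 2 ∈ S := hl2 ⟨by linarith, by linarith⟩
    have := csInf_le hbb this
    linarith
  have hB : ∀ t ∈ S, t < sSup S := by
    intro t ht
    refine lt_of_le_of_ne (le_csSup hba ht) ?_
    intro he
    obtain ⟨l, hl, hl2⟩ := exists_Ico_subset_of_mem_nhds (hopen.mem_nhds ht) ⟨t + 1, by simp⟩
    have : (l + t) / 2 ∈ S := hl2 ⟨by linarith, by linarith⟩
    have := le_csSup hba this
    linarith
  obtain ⟨z, hz⟩ := hne
  refine ⟨sInf S, sSup S, le_csInf ⟨z, hz⟩ fun t ht => (hsub ht).1, (hA z hz).trans (hB z hz),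
    csSup_le ⟨z, hz⟩ fun t ht => (hsub ht).2, ?_, ?_⟩
  · intro t ht
    obtain ⟨t₀, h1, h2⟩ := (csInf_lt_iff hbb ⟨z, hz⟩).1 ht.1
    obtain ⟨t₁, h3, h4⟩ := (lt_csSup_iff hba ⟨z, hz⟩).1 ht.2
    exact hpos t (hconv t₀ h1 t₁ h3 t h2 h4)
  · intro t ht
    by_contra hcon
    exact ht ⟨hA t hcon, hB t hcon⟩

lemma aux_exists_G (G : Set ℝ) (a b : ℝ) (hG : ∀ᵐ t ∂volume, t ∈ Set.Ioo a b → t ∈ G)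
    (l r : ℝ) (hlr : l < r) (hal : a ≤ l) (hrb : r ≤ b) : ∃ p ∈ Set.Ioo l r, p ∈ G := by
  by_contra hcon
  push Not at hcon
  have hz : volume (Set.Ioo l r) = 0 := by
    refine measure_mono_null ?_ hG
    intro t ht ht'
    exact hcon t ht (ht' ⟨hal.trans_lt ht.1, ht.2.trans_le hrb⟩)
  rw [Real.volume_Ioo, ENNReal.ofReal_eq_zero] at hz
  linarith

lemma aux_W (h : ℝ → ℝ) (hc : Continuous h) (E : Set ℝ) (f : ℕ → ℝ → ℝ)
    (hf : ∀ n, ∃ K : NNReal, LipschitzWith K (f n))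
    (p q : ℝ) (hp : Tendsto (fun n => f n p) atTop (𝓝 (E.indicator (fun _ => (1:ℝ)) p)))
    (hq : Tendsto (fun n => f n q) atTop (𝓝 (E.indicator (fun _ => (1:ℝ)) q)))
    (hpq : p < q) (hne : ¬ (p ∈ E ↔ q ∈ E)) (κ : ℝ) 
    (hκ : ∀ t ∈ Set.Icc p q, κ ≤ h t) :
    liminf (fun n => ∫⁻ t in Set.Iic p, ENNReal.ofReal |deriv (f n) t| ∂(densMeasure h)) atTop
      + ENNReal.ofReal κ ≤
    liminf (fun n => ∫⁻ t in Set.Iic q, ENNReal.ofReal |deriv (f n) t| ∂(densMeasure h)) atTop := by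
  have h1 : ∀ n, ∫⁻ t in Set.Iic q, ENNReal.ofReal |deriv (f n) t| ∂(densMeasure h) =
      ∫⁻ t in Set.Iic p, ENNReal.ofReal |deriv (f n) t| ∂(densMeasure h) +
      ∫⁻ t in Set.Ioc p q, ENNReal.ofReal |deriv (f n) t| ∂(densMeasure h) := by
    intro n
    rw [← Set.Iic_union_Ioc_eq_Iic hpq.le, lintegral_union measurableSet_Ioc]
    rw [Set.disjoint_left]
    intro t ht ht'
    exact absurd ht (not_le.2 ht'.1)
  simp_rw [h1]
  refine le_trans (add_le_add le_rfl ?_) (aux_liminf_add _ _)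
  have h2 : Tendsto (fun n => ENNReal.ofReal κ * ENNReal.ofReal |f n q - f n p|) atTop
      (𝓝 (ENNReal.ofReal κ * ENNReal.ofReal 1)) := by
    refine ENNReal.Tendsto.const_mul (ENNReal.tendsto_ofReal ?_) (Or.inr ENNReal.ofReal_ne_top)
    have h3 := (hq.sub hp).abs
    convert h3 using 2
    by_cases hpE : p ∈ E
    · have hqE : q ∉ E := by tauto
      simp [hpE, hqE]
    · have hqE : q ∈ E := by tauto
      simp [hpE, hqE]
  rw [ENNReal.ofReal_one, mul_one] at h2
  rw [← h2.liminf_eq]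
  exact liminf_le_liminf (Filter.Eventually.of_forall fun n =>
    aux_ftc h (f n) (hf n) p q κ hpq.le hκ hc.measurable)

lemma aux_profile_le (K N D v : ℝ) (g : ℝ → ℝ) (hg : memSynthF K N D g) (A : Set ℝ)
    (hA : MeasurableSet A) (hs : A ⊆ Set.Icc 0 D) (hv : densMeasure g A = ENNReal.ofReal v) :
    synthProfile K N D v ≤ minkOn (Set.Icc 0 D) (densMeasure g) A :=
  sInf_le ⟨g, hg, A, hA, hs, hv, rfl⟩

lemma aux_core (K N D : ℝ) (hN : 1 < N) (h : ℝ → ℝ) (hF : memSynthF K N D h)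
    (v : ℝ) (E : Set ℝ) (hEsub : E ⊆ Set.Icc 0 D) 
    (hvol : densMeasure h E = ENNReal.ofReal v) (a b : ℝ) (ha : 0 ≤ a) (hab : a < b) (hb : b ≤ D)
    (hpos : ∀ t ∈ Set.Ioo a b, 0 < h t) (hzero : ∀ t, t ∉ Set.Ioo a b → h t = 0)
    (f : ℕ → ℝ → ℝ) (hf : ∀ n, ∃ K : NNReal, LipschitzWith K (f n))
    (hG : ∀ᵐ t ∂volume, t ∈ Set.Ioo a b → 
      Tendsto (fun n => f n t) atTop (𝓝 (E.indicator (fun _ => (1:ℝ)) t)))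
    (δ : ℝ) (hδ : 0 < δ) :
    synthProfile K N D v ≤ ENNReal.ofReal (1 + δ) *
      liminf (fun n => ∫⁻ t, ENNReal.ofReal |deriv (f n) t| ∂(densMeasure h)) atTop
      + ENNReal.ofReal δ + ENNReal.ofReal δ := by
  classical
  have hF' := hF
  obtain ⟨h0, hsub, hprob, hcd, -⟩ := hF
  obtain ⟨hc, -⟩ := hcd hN
  set W : ℝ → ℝ≥0∞ := fun q => 
    liminf (fun n => ∫⁻ t in Set.Iic q, ENNReal.ofReal |deriv (f n) t| ∂(densMeasure h)) atTop
    with hWdef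
  have hWm : Monotone W := by
    intro p q hpq
    exact liminf_le_liminf (Filter.Eventually.of_forall fun n =>
      lintegral_mono_set (Set.Iic_subset_Iic.2 hpq))
  set G : Set ℝ := {t | Tendsto (fun n => f n t) atTop (𝓝 (E.indicator (fun _ => (1:ℝ)) t))}
    with hGdef
  have hG' : ∀ᵐ t ∂volume, t ∈ Set.Ioo a b → t ∈ G := hG
  -- smallness near the end points
  have hua : UniformContinuous h := by
    apply HasCompactSupport.uniformContinuous_of_continuous _ hc
    exact HasCompactSupport.intro (isCompact_Icc (a := 0) (b := D)) fun t ht => by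
      by_contra hcon
      exact ht (hsub hcon)
  rw [Metric.uniformContinuous_iff] at hua
  obtain ⟨η, hη, hη2⟩ := hua δ hδ
  have hsmallL : ∀ t, t < a + η → h t ≤ δ := by
    intro t ht
    by_cases hta : t ≤ a
    · rw [hzero t (fun h => absurd h.1 (not_lt.2 hta))]; exact hδ.le
    · have := hη2 (a := t) (b := a) (by rw [Real.dist_eq, abs_lt]; constructor <;> linarith)
      rw [Real.dist_eq, hzero a (fun h => absurd h.1 (lt_irrefl _)), abs_lt] at this
      linarith [this.2]
  have hsmallR : ∀ t, b - η < t → h t ≤ δ := by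
    intro t ht
    by_cases hta : b ≤ t
    · rw [hzero t (fun h => absurd h.2 (not_lt.2 hta))]; exact hδ.le
    · have := hη2 (a := t) (b := b) (by rw [Real.dist_eq, abs_lt]; constructor <;> linarith)
      rw [Real.dist_eq, hzero b (fun h => absurd h.2 (lt_irrefl _)), abs_lt] at this
      linarith [this.2]
  obtain ⟨x, hx, hxG⟩ := aux_exists_G G a b hG' a (min (a + η / 2) ((a + b) / 2))
    (lt_min (by linarith) (by linarith)) le_rfl ((min_le_right _ _).trans (by linarith))
  obtain ⟨y, hy, hyG⟩ := aux_exists_G G a b hG' (max (b - η / 2) ((a + b) / 2)) b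
    (max_lt (by linarith) (by linarith)) (le_trans (by linarith) (le_max_right _ _)) le_rfl
  have hx1 := hx.1
  have hx2 := hx.2.trans_le (min_le_left _ _)
  have hx3 := hx.2.trans_le (min_le_right _ _)
  have hy1 := hy.2
  have hy2 := (le_max_left _ _).trans_lt hy.1
  have hy3 := (le_max_right _ _).trans_lt hy.1
  have hxy : x ≤ y := by linarith
  have hIcc : Set.Icc x y ⊆ Set.Ioo a b := fun t ht => ⟨hx1.trans_le ht.1, ht.2.trans_lt hy1⟩
  obtain ⟨τ, hτ, hmin⟩ := (isCompact_Icc (a := x) (b := y)).exists_isMinOn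
      ⟨x, le_rfl, hxy⟩ hc.continuousOn
  have hmin' : ∀ t ∈ Set.Icc x y, h τ ≤ h t := fun t ht => hmin ht
  have hτpos := hpos τ (hIcc hτ)
  obtain ⟨r, hr, hr2⟩ := hua (δ * h τ) (by positivity)
  have hosc : ∀ s, ∀ t ∈ Set.Icc x y, |s - t| ≤ 2 * (r / 4) → h s ≤ (1 + δ) * h t := by
    intro s t ht hst
    have := hr2 (a := s) (b := t) (by rw [Real.dist_eq]; linarith)
    rw [Real.dist_eq, abs_lt] at this
    nlinarith [this.2, hmin' t ht]
  -- base
  have hstart : InvC h E (-1) (¬ x ∈ E) 0 (if x ∈ E then ∅ else Set.univ) := by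
    have hnull : densMeasure h (Set.Iic (-1)) = 0 := by
      unfold densMeasure
      rw [withDensity_apply _ measurableSet_Iic, setLIntegral_eq_zero measurableSet_Iic]
      intro t ht
      have : t ≤ -1 := ht
      simp [hzero t (fun h => by linarith [h.1])]
    refine ⟨?_, ?_, ?_, ?_, ?_⟩
    · split_ifs <;> simp
    · intro hxE; simp [hxE]
    · intro hxE; rw [not_not] at hxE; simp [hxE]
    · rw [measure_mono_null Set.inter_subset_right hnull,
        measure_mono_null Set.inter_subset_right hnull]
    · split_ifs <;> simp
  obtain ⟨A₀, hA₀⟩ := hstart.step hc h0 (by linarith) δ (η / 2) (by linarith) (q' := x) (by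
    intro t ht
    exact hsmallL t (by linarith [ht.2]))
  rw [not_not] at hA₀
  obtain ⟨A₁, hA₁⟩ := aux_chain hc h0 G W x y δ (r / 4) hδ (by linarith)
    (by filter_upwards [hG'] with t ht ht' using ht (hIcc ht')) hWm
    (fun p hp q hq _ _ hpq hne κ _ hκ => aux_W h hc E f hf p q hp hq hpq hne κ hκ)
    hosc hxG hyG hxy ⟨A₀, hA₀.mono (by rw [zero_add]; exact le_add_self)⟩
  obtain ⟨A, hA⟩ := hA₁.step hc h0 (by linarith) δ (η / 2) (by linarith) (q' := D + 1) (by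
    intro t ht
    exact hsmallR t (by linarith [ht.1]))
  obtain ⟨b1, -, -, b4, b5⟩ := hA
  have haeD : ∀ᵐ t ∂(densMeasure h), t ∈ Set.Icc 0 D := by
    unfold densMeasure
    rw [ae_withDensity_iff (by fun_prop)]
    refine Filter.Eventually.of_forall fun t ht => ?_
    by_contra hcon
    simp only [ne_eq, ENNReal.ofReal_eq_zero, not_le] at ht
    exact hcon (hsub ht.ne')
  refine (aux_profile_le K N D v h hF' (A ∩ Set.Icc 0 D) (b1.inter measurableSet_Icc)
    Set.inter_subset_right ?_).trans ((aux_mink_le D _ A _ b5).trans ?_)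
  · rw [← hvol]
    have e1 : E ∩ Set.Iic (D + 1) = E :=
      Set.inter_eq_left.2 fun t ht => by have := (hEsub ht).2; simp; linarith
    rw [e1] at b4
    rw [← b4]
    apply measure_congr
    filter_upwards [haeD] with t ht
    apply propext
    change (t ∈ A ∧ t ∈ Set.Icc 0 D) ↔ (t ∈ A ∧ t ≤ D + 1)
    have : t ≤ D + 1 := by linarith [ht.2]
    tauto
  · gcongr
    exact liminf_le_liminf (Filter.Eventually.of_forall fun n => setLIntegral_le_lintegral _ _)

lemma aux_core' (K N D : ℝ) (hN : 1 < N) (h : ℝ → ℝ) (hF : memSynthF K N D h)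
    (v : ℝ) (E : Set ℝ) (hEsub : E ⊆ Set.Icc 0 D) 
    (hvol : densMeasure h E = ENNReal.ofReal v) (a b : ℝ) (ha : 0 ≤ a) (hab : a < b) (hb : b ≤ D)
    (hpos : ∀ t ∈ Set.Ioo a b, 0 < h t) (hzero : ∀ t, t ∉ Set.Ioo a b → h t = 0)
    (f : ℕ → ℝ → ℝ) (hf : ∀ n, ∃ K : NNReal, LipschitzWith K (f n))
    (hG : ∀ᵐ t ∂volume, t ∈ Set.Ioo a b → 
      Tendsto (fun n => f n t) atTop (𝓝 (E.indicator (fun _ => (1:ℝ)) t))) :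
    synthProfile K N D v ≤ 
      liminf (fun n => ∫⁻ t, ENNReal.ofReal |deriv (f n) t| ∂(densMeasure h)) atTop := by
  set P := liminf (fun n => ∫⁻ t, ENNReal.ofReal |deriv (f n) t| ∂(densMeasure h)) atTop
  by_cases hP : P = ∞
  · rw [hP]; exact le_top
  have ht : Tendsto (fun δ : ℝ => ENNReal.ofReal (1 + δ) * P + ENNReal.ofReal δ + ENNReal.ofReal δ)
      (𝓝[>] 0) (𝓝 (ENNReal.ofReal (1 + 0) * P + ENNReal.ofReal 0 + ENNReal.ofReal 0)) := by
    have hid : Tendsto (fun δ : ℝ => δ) (𝓝[>] 0) (𝓝 0) := nhdsWithin_le_nhds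
    refine ((ENNReal.Tendsto.mul_const (ENNReal.tendsto_ofReal (hid.const_add 1))
      (Or.inr hP)).add (ENNReal.tendsto_ofReal hid)).add (ENNReal.tendsto_ofReal hid)
  simp only [add_zero, ENNReal.ofReal_one, one_mul, ENNReal.ofReal_zero] at ht
  refine ge_of_tendsto ht ?_
  filter_upwards [self_mem_nhdsWithin] with δ hδ
  exact aux_core K N D hN h hF v E hEsub hvol a b ha hab hb hpos hzero f hf hG δ hδ

lemma aux_main (K N D : ℝ) (hN : 1 < N) (hD : 0 < D) (h : ℝ → ℝ)
    (hF : memSynthF K N D h) (v : ℝ) 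
    (E : Set ℝ) (hE : MeasurableSet E) (hEsub : E ⊆ Set.Icc 0 D)
    (hvol : densMeasure h E = ENNReal.ofReal v) :
    synthProfile K N D v ≤ perimeterOn (Set.Icc 0 D) (densMeasure h) E := by
  obtain ⟨a, b, ha, hab, hb, hpos, hzero⟩ := aux_supp K N D hN h hF
  have hc : Continuous h := (hF.2.2.2.1 hN).1
  unfold perimeterOn perimeter
  refine le_sInf ?_
  rintro _ ⟨u, hu, hL1, rfl⟩
  by_contra hcon
  push Not at hcon
  obtain ⟨I', hI1, hI2⟩ := exists_between hcon
  obtain ⟨φ, hφ, hφ2⟩ := extraction_of_frequently_atTop (frequently_lt_of_liminf_lt (by isBoundedDefault) hI1)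
  have hzero' : ∀ t, t ∉ Set.Ioo 0 D → h t = 0 := fun t ht =>
    hzero t fun h => ht ⟨ha.trans_lt h.1, h.2.trans_le hb⟩
  have hlip : ∀ n, ∃ K : NNReal, LipschitzWith K (Set.IccExtend hD.le (u n)) := by
    intro n
    obtain ⟨K, hK⟩ := hu n
    refine ⟨K, ?_⟩
    have := hK.comp (LipschitzWith.projIcc hD.le)
    simpa [Set.IccExtend] using this
  have hL2 : Tendsto (fun n => eLpNorm (Set.IccExtend hD.le (u n) - E.indicator (fun _ => (1:ℝ))) 1
      ((densMeasure h).restrict (Set.Icc 0 D))) atTop (𝓝 0) := by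
    refine hL1.congr fun n => ?_
    rw [eLpNorm_one_eq_lintegral_enorm]
    rw [← lintegral_subtype_comap measurableSet_Icc]
    apply lintegral_congr
    intro x
    rw [Real.enorm_eq_ofReal_abs]
    simp only [Pi.sub_apply, Set.IccExtend_val]
    rfl
  have hmeas := tendstoInMeasure_of_tendsto_eLpNorm one_ne_zero
    (fun n => by
      obtain ⟨K, hK⟩ := hlip (φ n)
      exact hK.continuous.aestronglyMeasurable)
    ((stronglyMeasurable_const.indicator hE).aestronglyMeasurable) (hL2.comp hφ.tendsto_atTop)
  obtain ⟨ψ, hψ, hae⟩ := hmeas.exists_seq_tendsto_ae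
  have hG : ∀ᵐ t ∂volume, t ∈ Set.Ioo a b → 
      Tendsto (fun n => Set.IccExtend hD.le (u (φ (ψ n))) t) atTop
        (𝓝 (E.indicator (fun _ => (1:ℝ)) t)) := by
    rw [ae_restrict_iff' measurableSet_Icc] at hae
    unfold densMeasure at hae
    rw [ae_withDensity_iff (by fun_prop)] at hae
    filter_upwards [hae] with t ht ht'
    exact ht (by simpa using hpos t ht') ⟨ha.trans ht'.1.le, ht'.2.le.trans hb⟩
  have key := aux_core' K N D hN h hF v E hEsub hvol a b ha hab hb hpos hzero
    (fun n => Set.IccExtend hD.le (u (φ (ψ n)))) (fun n => hlip _) hG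
  refine absurd (key.trans ?_) (not_le.2 hI2)
  refine liminf_le_of_frequently_le' (Filter.Eventually.frequently
    (Filter.Eventually.of_forall fun n => ?_))
  exact (aux_slope_int D hD.le _ (hu _) h hzero' hc.measurable).trans (hφ2 (ψ n)).le

lemma aux_one (K D : ℝ) (hD : 0 < D) (v : ℝ) (hv : v ∈ Set.Icc (0:ℝ) 1) :
    synthProfile K 1 D v = 0 := by
  obtain ⟨hv0, hv1⟩ := hv
  set A : Set ℝ := Set.Icc 0 (v * D / 2) with hAdef
  set B : Set ℝ := Set.Icc (D - (1 - v) * D / 2) D with hBdef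
  have hvD : 0 ≤ v * D := by positivity
  have hvD' : 0 ≤ (1 - v) * D := mul_nonneg (by linarith) hD.le
  have e : v * D + (1 - v) * D = D := by ring
  have hAB : Disjoint A B := by
    rw [Set.disjoint_left]
    intro t ht ht'
    linarith [ht.2, ht'.1]
  set g : ℝ → ℝ := (A ∪ B).indicator (fun _ => 2 / D) with hg
  have hmAB : MeasurableSet (A ∪ B) := measurableSet_Icc.union measurableSet_Icc
  have hmeas : ∀ T, MeasurableSet T → densMeasure g T =
      ENNReal.ofReal (2 / D) * volume (T ∩ (A ∪ B)) := by
    intro T hT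
    unfold densMeasure
    rw [withDensity_apply _ hT]
    have : (fun t => ENNReal.ofReal (g t)) =
        (A ∪ B).indicator (fun _ => ENNReal.ofReal (2 / D)) := by
      ext t
      by_cases ht : t ∈ A ∪ B <;> simp only [hg, Set.indicator, ht, if_true, if_false, ENNReal.ofReal_zero]
    rw [this, lintegral_indicator hmAB, setLIntegral_const, Measure.restrict_apply hmAB,
      Set.inter_comm]
  have hsupp : Function.support g = A ∪ B := by
    rw [hg, Set.support_indicator]
    apply Set.inter_eq_left.2
    intro t _
    simp [hD.ne']
  have hsub : A ∪ B ⊆ Set.Icc 0 D := by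
    rintro t (ht | ht)
    · exact ⟨ht.1, by linarith [ht.2]⟩
    · exact ⟨by linarith [ht.1], ht.2⟩
  have hvolA : volume A = ENNReal.ofReal (v * D / 2) := by
    rw [hAdef, Real.volume_Icc, sub_zero]
  have hvolB : volume B = ENNReal.ofReal ((1 - v) * D / 2) := by
    rw [hBdef, Real.volume_Icc]; congr 1; ring
  have hgF : memSynthF K 1 D g := by
    refine ⟨?_, ?_, ⟨?_⟩, fun h => absurd h (lt_irrefl _), fun _ => ?_⟩
    · intro t
      apply Set.indicator_nonneg
      intro _ _
      positivity
    · rw [hsupp]; exact hsub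
    · rw [hmeas _ MeasurableSet.univ, Set.univ_inter, measure_union hAB measurableSet_Icc, hvolA,
        hvolB, ← ENNReal.ofReal_add (by positivity) (by positivity),
        ← ENNReal.ofReal_mul (by positivity)]
      rw [← ENNReal.ofReal_one]
      congr 1
      field_simp
      ring
    · rw [hsupp, (isClosed_Icc.union isClosed_Icc).closure_eq]
      intro t₀ ht₀ t₁ ht₁
      rw [hg, Set.indicator_of_mem (show t₀ ∈ A ∪ B from ht₀), Set.indicator_of_mem (show t₁ ∈ A ∪ B from ht₁)]
  have hmA : MeasurableSet A := measurableSet_Icc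
  have hAsub : A ⊆ Set.Icc 0 D := Set.subset_union_left.trans hsub
  rw [← nonpos_iff_eq_zero]
  refine (aux_profile_le K 1 D v g hgF A hmA hAsub ?_).trans ?_
  · rw [hmeas A hmA, Set.inter_eq_left.2 Set.subset_union_left, hvolA,
      ← ENNReal.ofReal_mul (by positivity)]
    congr 1
    field_simp
  · have := aux_mink_le D (densMeasure g) A 0 (by
      have hsm : ∀ᶠ ε in 𝓝[>] (0:ℝ), ε < D / 2 := nhdsWithin_le_nhds (Iio_mem_nhds (by linarith))
      filter_upwards [hsm, self_mem_nhdsWithin] with ε h1 h2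
      rw [mul_zero, nonpos_iff_eq_zero, hmeas _ (Metric.isClosed_cthickening.measurableSet.diff hmA)]
      have : (Metric.cthickening ε A \ A) ∩ (A ∪ B) = ∅ := by
        ext t
        simp only [Set.mem_inter_iff, Set.mem_sdiff, Set.mem_union, Set.mem_empty_iff_false, iff_false]
        rintro ⟨⟨h3, h4⟩, h5 | h5⟩
        · exact h4 h5
        · have h6 : t ≤ v * D / 2 + ε := aux_cth_Iic _ ε h2
            (Metric.cthickening_subset_of_subset ε (fun s hs => hs.2) h3)
          linarith [h5.1]
      rw [this, measure_empty, mul_zero])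
    rwa [Set.inter_eq_left.2 hAsub] at this

/-- For every `μ = h·L¹ ∈ F^s_{K,N,D}`, `v ∈ [0,1]` and Borel `E ⊆ [0,D]` with
`μ(E) = v`, one has `P_{([0,D],|·|,μ)}(E) ≥ I^s_{K,N,D}(v)`. -/
theorem perimeter_ge_synthProfile (K N D : ℝ) (hN : 1 ≤ N) (hD : 0 < D) (h : ℝ → ℝ)
    (hF : memSynthF K N D h) (v : ℝ) (hv : v ∈ Set.Icc (0:ℝ) 1)
    (E : Set ℝ) (hE : MeasurableSet E) (hEsub : E ⊆ Set.Icc 0 D)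
    (hvol : densMeasure h E = ENNReal.ofReal v) :
    synthProfile K N D v ≤ perimeterOn (Set.Icc 0 D) (densMeasure h) E := by
  rcases eq_or_lt_of_le hN with h1 | h1
  · rw [← h1, aux_one K D hD v hv]
    exact bot_le
  · exact aux_main K N D h1 hD h hF v E hE hEsub hvol
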